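/- Let R = R_1 × … × R_ℓ be a product of finite local rings with Jacobson radical J, let σ : R^n → ℕ^u be a modular support, and let 0 ≠ C ⊆ R^n be an R-linear code such that either C ⊆ 0:_{R^n} J or each R_j is a finite chain ring. Then min wt(C) = d_1(C) < d_2(C) < … < d_{M(C)}(C) = |σ(0:_C J)|; that is, the generalized weights of C form a strictly increasing sequence, starting at the minimum weight and ending at |σ(0:_C J)|. -/

import Mathlib

/-- Least cardinality of a system of generators of a submodule (`μ`), with `μ(0)=0`. -/
noncomputable def mu (R : Type*) {M : Type*} [Semiring R] [AddCommMonoid M] [Module R M]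
    (D : Submodule R M) : ℕ :=
  sInf {k | ∃ s : Finset M, s.card = k ∧ Submodule.span R (s : Set M) = D}

/-- `G` is a minimal system of generators of the submodule `D`. -/
def IsMinGenSet (R : Type*) {M : Type*} [Semiring R] [AddCommMonoid M] [Module R M]
    (G : Set M) (D : Submodule R M) : Prop :=
  Submodule.span R G = D ∧ ∀ G' ⊆ G, Submodule.span R G' = D → G' = G

/-- The socle `0 :_C J`, where `J` is the Jacobson radical of `R`. -/
noncomputable def socJ {R M : Type*} [CommRing R] [AddCommGroup M] [Module R M]
    (C : Submodule R M) : Submodule R M :=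
  C ⊓ ⨅ r ∈ (⊥ : Ideal R).jacobson, LinearMap.ker (LinearMap.lsmul R M r)

/-- `D ∈ 𝒮_j(C)`: `D` is a subcode of `C` having a minimal system of generators of card `j`. -/
def memS {R M : Type*} [Semiring R] [AddCommMonoid M] [Module R M]
    (j : ℕ) (C D : Submodule R M) : Prop :=
  D ≤ C ∧ ∃ G : Finset M, G.card = j ∧ IsMinGenSet R (↑G : Set M) D

/-- The (componentwise) support of a set of vectors. -/
noncomputable def suppOf {M : Type*} {u : ℕ} (σ : M → Fin u → ℕ) (D : Set M) : Fin u → ℕ :=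
  fun i => sSup ((fun v => σ v i) '' D)

/-- The `r`-th generalized weight `d_r(C)`. -/
noncomputable def dGW {R M : Type*} [Semiring R] [AddCommMonoid M] [Module R M] {u : ℕ}
    (σ : M → Fin u → ℕ) (r : ℕ) (C : Submodule R M) : ℕ :=
  sInf {w | ∃ j, r ≤ j ∧ ∃ D : Submodule R M, memS j C D ∧ w = ∑ i, suppOf σ (D : Set M) i}

/-- `σ` is a support on `R^n`: (P1), (P2), (P3). -/
def IsSupport {R : Type*} [CommRing R] {n u : ℕ} (σ : (Fin n → R) → Fin u → ℕ) : Prop :=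
  (∀ v, σ v = 0 ↔ v = 0) ∧ (∀ (r : R) (v), σ (r • v) ≤ σ v) ∧ (∀ v w, σ (v + w) ≤ σ v ⊔ σ w)

/-- `σ` is modular: property (P⋆). -/
def IsModular {R : Type*} [CommRing R] {n u : ℕ} (σ : (Fin n → R) → Fin u → ℕ) : Prop :=
  ∀ v w (i : Fin u), σ v i ≠ 0 → σ v i ≤ σ w i → ∃ r : R, σ (v + r • w) i < σ v i

/-- The set of minimal (support) elements of a set `S` w.r.t. `σ`. -/
def MinSet {M : Type*} [Zero M] {u : ℕ} (σ : M → Fin u → ℕ) (S : Set M) : Set M :=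
  {v | v ∈ S ∧ v ≠ 0 ∧ ∀ w ∈ S, w ≠ 0 → σ w ≤ σ v → σ w = σ v}

/-- The `j`-th projected code `C_j ⊆ R_j^n`. -/
noncomputable def projCode {ℓ n : ℕ} {Rj : Fin ℓ → Type*} [∀ j, CommRing (Rj j)]
    (C : Submodule (∀ j, Rj j) (Fin n → ∀ j, Rj j)) (j : Fin ℓ) :
    Submodule (Rj j) (Fin n → Rj j) :=
  Submodule.span (Rj j) {w | ∃ v ∈ C, w = fun i => v i j}

/-- `M(C) = μ(C_1) + ⋯ + μ(C_ℓ)`. -/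
noncomputable def Mnum {ℓ n : ℕ} {Rj : Fin ℓ → Type*} [∀ j, CommRing (Rj j)]
    (C : Submodule (∀ j, Rj j) (Fin n → ∀ j, Rj j)) : ℕ :=
  ∑ j, mu (Rj j) (projCode C j)


section LenPart

variable {R M : Type*} [CommRing R] [AddCommGroup M] [Module R M]

/-- Length of a submodule as a natural number. -/
noncomputable def len (N : Submodule R M) : ℕ := (Module.length R N).toNat

lemma coe_len [Finite M] (N : Submodule R M) : (len N : ℕ∞) = Module.length R N := by
  unfold len
  exact ENat.natCast_toNat Module.length_ne_top

lemma len_mono [Finite M] {N N' : Submodule R M} (h : N ≤ N') : len N ≤ len N' := by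
  have : (len N : ℕ∞) ≤ len N' := by
    rw [coe_len, coe_len, Module.length_submodule, Module.length_submodule]
    exact Order.height_mono h
  exact_mod_cast this

lemma len_lt [Finite M] {N N' : Submodule R M} (h : N < N') : len N < len N' := by
  have : (len N : ℕ∞) < len N' := by
    rw [coe_len, coe_len, Module.length_submodule, Module.length_submodule]
    exact Submodule.height_strictMono h
  exact_mod_cast this

lemma len_bot : len (⊥ : Submodule R M) = 0 := by
  simp [len]

lemma len_map_add {P : Type*} [AddCommGroup P] [Module R P] [Finite M] [Finite P]
    (f : M →ₗ[R] P) (N : Submodule R M) :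
    len (N ⊓ LinearMap.ker f) + len (N.map f) = len N := by
  have hm : ∀ x : N, f x ∈ N.map f := fun x => Submodule.mem_map_of_mem x.2
  have := Module.length_eq_add_of_exact
    (Submodule.inclusion (inf_le_left : N ⊓ LinearMap.ker f ≤ N))
    ((f.comp N.subtype).codRestrict (N.map f) hm)
    (Submodule.inclusion_injective _)
    (by
      rintro ⟨y, x, hx, rfl⟩
      exact ⟨⟨x, hx⟩, rfl⟩)
    (by
      intro x
      constructor
      · intro h
        have h' : f x = 0 := congrArg Subtype.val h
        exact ⟨⟨x, x.2, h'⟩, rfl⟩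
      · rintro ⟨⟨y, hy, hy'⟩, rfl⟩
        exact Subtype.ext hy')
  rw [← coe_len, ← coe_len, ← coe_len] at this
  exact_mod_cast this.symm

lemma len_step [Finite M] {N N' : Submodule R M} (hle : N ≤ N')
    (h : ∀ x ∈ N', x ∉ N → ∀ y ∈ N', ∃ r : R, y + r • x ∈ N) : len N' ≤ len N + 1 := by
  have : Finite (M ⧸ N) := Finite.of_surjective _ N.mkQ_surjective
  have h1 := len_map_add N.mkQ N'
  rw [Submodule.ker_mkQ, inf_eq_right.2 hle] at h1
  suffices len (N'.map N.mkQ) ≤ 1 by omega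
  have : (len (N'.map N.mkQ) : ℕ∞) ≤ 1 := by
    rw [coe_len]
    rcases subsingleton_or_nontrivial (N'.map N.mkQ) with hs | hs
    · simp
    · have : IsSimpleModule R (N'.map N.mkQ) := by
        rw [isSimpleModule_iff_toSpanSingleton_surjective]
        refine ⟨hs, ?_⟩
        rintro ⟨_, x, hx, rfl⟩ hx0 ⟨_, y, hy, rfl⟩
        have hxN : x ∉ N := by
          intro hxN
          apply hx0
          ext
          simpa using hxN
        obtain ⟨r, hr⟩ := h x hx hxN y hy
        refine ⟨-r, ?_⟩
        ext
        have : N.mkQ (y + r • x) = 0 := (Submodule.Quotient.mk_eq_zero N).2 hr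
        rw [map_add, map_smul] at this
        simp only [LinearMap.toSpanSingleton_apply, neg_smul]
        change -(r • N.mkQ x) = N.mkQ y
        exact neg_eq_of_add_eq_zero_left this
      rw [Module.length_eq_one]
  exact_mod_cast this

/-- upper bound for the length of a span modulo `K`. -/
lemma len_span_le [Finite M] (K : Submodule R M) (A : Finset M)
    (h : ∀ g ∈ A, ∀ r : R, r • g ∈ K ∨ ∃ s : R, s • r • g = g) :
    len (Submodule.span R (A : Set M) ⊔ K) ≤ A.card + len K := by
  classical
  induction A using Finset.induction_on with
  | empty => simp
  | insert g A hg ih =>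
    have ih' := ih (fun x hx => h x (Finset.mem_insert_of_mem hx))
    rw [Finset.card_insert_of_notMem hg]
    have hst : len (Submodule.span R ((insert g A : Finset M) : Set M) ⊔ K) ≤
        len (Submodule.span R (A : Set M) ⊔ K) + 1 := by
      have heq : Submodule.span R ((insert g A : Finset M) : Set M) ⊔ K =
          Submodule.span R {g} ⊔ (Submodule.span R (A : Set M) ⊔ K) := by
        rw [Finset.coe_insert, Submodule.span_insert, sup_assoc]
      rw [heq]
      apply len_step le_sup_right
      intro x hx hxN y hy
      obtain ⟨a, ha, n, hn, rfl⟩ := Submodule.mem_sup.1 hx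
      obtain ⟨b, hb, m, hm, rfl⟩ := Submodule.mem_sup.1 hy
      obtain ⟨r, rfl⟩ := Submodule.mem_span_singleton.1 ha
      obtain ⟨t, rfl⟩ := Submodule.mem_span_singleton.1 hb
      rcases h g (Finset.mem_insert_self _ _) r with h1 | ⟨s, hs⟩
      · exact absurd (add_mem (Submodule.mem_sup_right h1) hn) hxN
      · refine ⟨-(t * s), ?_⟩
        have : t • g + m + -(t * s) • (r • g + n) = m + -(t * s) • n := by
          rw [smul_add, neg_smul, mul_smul t s (r • g), hs]
          abel
        rw [this]
        exact add_mem hm (Submodule.smul_mem _ _ hn)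
    omega

/-- lower bound for the length of a span modulo `K`. -/
lemma le_len_span [Finite M] (K : Submodule R M) (G : Finset M)
    (h : ∀ A ⊂ G, ¬ Submodule.span R (G : Set M) ≤ Submodule.span R (A : Set M) ⊔ K) :
    G.card + len K ≤ len (Submodule.span R (G : Set M) ⊔ K) := by
  classical
  suffices H : ∀ A : Finset M, A ⊆ G →
      A.card + len K ≤ len (Submodule.span R (A : Set M) ⊔ K) from H G subset_rfl
  intro A
  induction A using Finset.induction_on with
  | empty => simp
  | insert g A hg ih =>
    intro hA
    have ih' := ih ((Finset.subset_insert _ _).trans hA)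
    rw [Finset.card_insert_of_notMem hg]
    have hst : len (Submodule.span R (A : Set M) ⊔ K) <
        len (Submodule.span R ((insert g A : Finset M) : Set M) ⊔ K) := by
      apply len_lt
      refine lt_of_le_of_ne (sup_le_sup_right (Submodule.span_mono (by simp)) _) ?_
      intro heq
      have hgm : g ∈ Submodule.span R (A : Set M) ⊔ K := by
        rw [heq]
        exact Submodule.mem_sup_left (Submodule.subset_span (by simp))
      have hgG : g ∈ G := hA (Finset.mem_insert_self _ _)
      apply h (G.erase g) (Finset.erase_ssubset hgG)
      rw [Submodule.span_le]
      intro x hx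
      by_cases hxg : x = g
      · subst hxg
        refine (sup_le_sup_right (Submodule.span_mono (R := R) ?_) K :
          Submodule.span R (A : Set M) ⊔ K ≤ _) hgm
        intro z hz
        simp only [Finset.coe_erase, Set.mem_sdiff, Finset.mem_coe, Set.mem_singleton_iff]
        refine ⟨hA (Finset.mem_insert_of_mem hz), ?_⟩
        rintro rfl
        exact hg hz
      · exact Submodule.mem_sup_left (Submodule.subset_span (by simpa [hxg] using hx))
    omega

lemma card_le_of_min [Finite M] {G : Finset M} {D : Submodule R M}
    (h : IsMinGenSet R (G : Set M) D) :
    G.card + len ((⊥ : Ideal R).jacobson • D) ≤ len D := by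
  obtain ⟨rfl, hmin⟩ := h
  refine (le_len_span ((⊥ : Ideal R).jacobson • Submodule.span R (G : Set M)) G ?_).trans
    (len_mono (sup_le le_rfl Submodule.smul_le_right))
  intro A hA hle
  have h1 := Submodule.le_of_le_smul_of_le_jacobson_bot ⟨G, rfl⟩ le_rfl hle
  have h2 := hmin A (by exact_mod_cast hA.1)
    (le_antisymm (Submodule.span_mono (by exact_mod_cast hA.1)) h1)
  exact hA.ne (by exact_mod_cast h2)

lemma mem_socJ {C : Submodule R M} {v : M} :
    v ∈ socJ C ↔ v ∈ C ∧ ∀ r ∈ (⊥ : Ideal R).jacobson, r • v = 0 := by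
  simp [socJ, Submodule.mem_iInf]

lemma len_soc_case1 {D : Submodule R M}
    (h : ∀ v ∈ D, ∀ r ∈ (⊥ : Ideal R).jacobson, r • v = 0) :
    len ((⊥ : Ideal R).jacobson • D) + len (socJ D) = len D := by
  have h1 : (⊥ : Ideal R).jacobson • D = ⊥ := by
    rw [eq_bot_iff, Submodule.smul_le]
    intro r hr v hv
    simpa using h v hv r hr
  have h2 : socJ D = D := by
    ext v
    rw [mem_socJ]
    exact ⟨fun h => h.1, fun hv => ⟨hv, h v hv⟩⟩
  rw [h1, h2, len_bot, zero_add]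

lemma len_soc_case2 [Finite M] [IsPrincipalIdealRing R] (D : Submodule R M) :
    len ((⊥ : Ideal R).jacobson • D) + len (socJ D) = len D := by
  obtain ⟨p, hp⟩ := IsPrincipalIdealRing.principal (⊥ : Ideal R).jacobson
  have hp' : (⊥ : Ideal R).jacobson = Ideal.span {p} := hp
  have h1 : (⊥ : Ideal R).jacobson • D = D.map (LinearMap.lsmul R M p) := by
    rw [hp', Submodule.ideal_span_singleton_smul]
    rfl
  have h2 : socJ D = D ⊓ LinearMap.ker (LinearMap.lsmul R M p) := by
    ext v
    rw [mem_socJ, hp']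
    constructor
    · rintro ⟨hv, h⟩
      exact ⟨hv, h p (Ideal.mem_span_singleton_self p)⟩
    · rintro ⟨hv, h⟩
      refine ⟨hv, fun r hr => ?_⟩
      obtain ⟨s, rfl⟩ := Ideal.mem_span_singleton'.1 hr
      have h' : p • v = 0 := h
      rw [mul_smul, h', smul_zero]
  rw [h1, h2, add_comm]
  exact len_map_add _ _

end LenPart

section GenPart

variable {ℓ n : ℕ} {Rj : Fin ℓ → Type*} [∀ j, CommRing (Rj j)]

/-- Embedding of `R_j^n` into `R^n`. -/
def emb (j : Fin ℓ) (w : Fin n → Rj j) : Fin n → ∀ j, Rj j := fun i => Pi.single j (w i)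

lemma emb_inj (j : Fin ℓ) : Function.Injective (emb (Rj := Rj) (n := n) j) := by
  intro a b h
  funext i
  exact Pi.single_injective j (congrFun h i)

lemma emb_same (j : Fin ℓ) (w : Fin n → Rj j) : (fun i => emb j w i j) = w := by
  funext i
  simp [emb]

lemma emb_ne {j k : Fin ℓ} (h : j ≠ k) (w : Fin n → Rj k) :
    (fun i => emb k w i j) = (0 : Fin n → Rj j) := by
  funext i
  simp [emb, Pi.single_eq_of_ne h]

lemma emb_zero (j : Fin ℓ) : emb j (0 : Fin n → Rj j) = 0 := by
  funext i
  simp [emb]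

lemma emb_add (j : Fin ℓ) (v w : Fin n → Rj j) : emb j (v + w) = emb j v + emb j w := by
  funext i
  simp [emb, Pi.single_add]

lemma emb_smul (j : Fin ℓ) (a : Rj j) (w : Fin n → Rj j) :
    emb j (a • w) = (Pi.single j a : ∀ j, Rj j) • emb j w := by
  funext i
  simp [emb, Pi.single_mul]

lemma smul_emb (j : Fin ℓ) (a : ∀ j, Rj j) (w : Fin n → Rj j) :
    a • emb j w = emb j (a j • w) := by
  funext i k
  by_cases h : k = j
  · subst h
    simp [emb]
  · simp [emb, Pi.single_eq_of_ne h]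

lemma emb_proj (j : Fin ℓ) (v : Fin n → ∀ j, Rj j) :
    emb j (fun i => v i j) = (Pi.single j 1 : ∀ j, Rj j) • v := by
  funext i k
  by_cases h : k = j
  · subst h
    simp [emb]
  · simp [emb, Pi.single_eq_of_ne h]

lemma sum_emb (v : Fin n → ∀ j, Rj j) : ∑ j, emb j (fun i => v i j) = v := by
  funext i k
  simp only [emb, Finset.sum_apply]
  rw [Finset.sum_eq_single k]
  · simp
  · intro b _ hb
    simp [Pi.single_eq_of_ne hb.symm]
  · simp

lemma emb_span_mem {N : Submodule (∀ j, Rj j) (Fin n → ∀ j, Rj j)} {j : Fin ℓ}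
    {s : Set (Fin n → Rj j)} (hs : ∀ w ∈ s, emb j w ∈ N) {w : Fin n → Rj j}
    (hw : w ∈ Submodule.span (Rj j) s) : emb j w ∈ N := by
  induction hw using Submodule.span_induction with
  | mem x hx => exact hs x hx
  | zero => rw [emb_zero]; exact zero_mem _
  | add x y _ _ hx hy => rw [emb_add]; exact add_mem hx hy
  | smul a x _ hx => rw [emb_smul]; exact Submodule.smul_mem _ _ hx

lemma emb_projCode {D : Submodule (∀ j, Rj j) (Fin n → ∀ j, Rj j)} {j : Fin ℓ}
    {w : Fin n → Rj j} (hw : w ∈ projCode D j) : emb j w ∈ D := by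
  refine emb_span_mem ?_ hw
  rintro _ ⟨v, hv, rfl⟩
  rw [emb_proj]
  exact Submodule.smul_mem _ _ hv

lemma proj_span_mem {s : Set (Fin n → ∀ j, Rj j)} {j : Fin ℓ}
    {N : Submodule (Rj j) (Fin n → Rj j)} (hs : ∀ v ∈ s, (fun i => v i j) ∈ N)
    {v : Fin n → ∀ j, Rj j} (hv : v ∈ Submodule.span (∀ j, Rj j) s) : (fun i => v i j) ∈ N := by
  induction hv using Submodule.span_induction with
  | mem x hx => exact hs x hx
  | zero => exact zero_mem N
  | add x y _ _ hx hy => exact add_mem hx hy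
  | smul a x _ hx => exact Submodule.smul_mem N (a j) hx

lemma exists_mu_gen [∀ j, Fintype (Rj j)] {j : Fin ℓ} (N : Submodule (Rj j) (Fin n → Rj j)) :
    ∃ s : Finset (Fin n → Rj j), s.card = mu (Rj j) N ∧
      Submodule.span (Rj j) (s : Set (Fin n → Rj j)) = N := by
  have hfg : N.FG := IsNoetherian.noetherian N
  obtain ⟨s, hs⟩ := hfg
  exact Nat.sInf_mem (s := {k | ∃ s : Finset (Fin n → Rj j), s.card = k ∧
    Submodule.span (Rj j) (s : Set (Fin n → Rj j)) = N}) ⟨_, s, rfl, hs⟩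

lemma mu_le_card {R M : Type*} [Semiring R] [AddCommMonoid M] [Module R M]
    {N : Submodule R M} (s : Finset M) (hs : Submodule.span R (s : Set M) = N) :
    mu R N ≤ s.card := Nat.sInf_le ⟨s, rfl, hs⟩

lemma single_mem_jac [∀ j, IsLocalRing (Rj j)] (j : Fin ℓ) (a : Rj j) (ha : ¬ IsUnit a) :
    (Pi.single j a : ∀ j, Rj j) ∈ (⊥ : Ideal (∀ j, Rj j)).jacobson := by
  rw [Ideal.mem_jacobson_bot]
  intro y
  rw [Pi.isUnit_iff]
  intro k
  by_cases h : k = j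
  · subst h
    have : a ∈ (⊥ : Ideal (Rj k)).jacobson := by
      rw [IsLocalRing.jacobson_eq_maximalIdeal _ bot_ne_top]
      exact ha
    simpa using Ideal.mem_jacobson_bot.1 this (y k)
  · simp [Pi.single_eq_of_ne h]

lemma exists_min_gen [∀ j, Fintype (Rj j)] [∀ j, IsLocalRing (Rj j)]
    (D : Submodule (∀ j, Rj j) (Fin n → ∀ j, Rj j)) :
    ∃ G : Finset (Fin n → ∀ j, Rj j), G.card = Mnum D ∧
      IsMinGenSet (∀ j, Rj j) (G : Set (Fin n → ∀ j, Rj j)) D ∧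
      ∀ g ∈ G, ∀ r : ∀ j, Rj j, r • g ∈ (⊥ : Ideal (∀ j, Rj j)).jacobson • D ∨
        ∃ s : ∀ j, Rj j, s • r • g = g := by
  classical
  choose s hcard hspan using fun j => exists_mu_gen (projCode D j)
  have hers : ∀ j, ∀ w ∈ s j, ¬ projCode D j ≤
      Submodule.span (Rj j) (((s j).erase w : Finset _) : Set (Fin n → Rj j)) := by
    intro j w hw hle
    have h1 := mu_le_card (N := projCode D j) ((s j).erase w) (le_antisymm (by
      conv_rhs => rw [← hspan j]
      exact Submodule.span_mono (by simp)) hle)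
    have := Finset.card_erase_lt_of_mem hw
    rw [hcard] at this
    omega
  have h0 : ∀ j, (0 : Fin n → Rj j) ∉ s j := by
    intro j h
    apply hers j 0 h
    rw [← hspan j, Finset.coe_erase, Submodule.span_sdiff_singleton_zero]
  have hmemD : ∀ j, ∀ w ∈ s j, emb j w ∈ D := by
    intro j w hw
    apply emb_projCode
    rw [← hspan j]
    exact Submodule.subset_span hw
  refine ⟨Finset.univ.biUnion fun j => (s j).image (emb j), ?_, ⟨?_, ?_⟩, ?_⟩
  · rw [Finset.card_biUnion]
    · unfold Mnum
      refine Finset.sum_congr rfl fun j _ => ?_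
      rw [Finset.card_image_of_injective _ (emb_inj j), hcard]
    · intro j _ k _ hjk
      refine Finset.disjoint_left.2 ?_
      intro x hx hx'
      obtain ⟨w, hw, rfl⟩ := Finset.mem_image.1 hx
      obtain ⟨w', hw', h⟩ := Finset.mem_image.1 hx'
      apply h0 j
      have h1 := emb_ne hjk w'
      rw [h, emb_same] at h1
      rwa [← h1]
  · apply le_antisymm
    · rw [Submodule.span_le]
      intro x hx
      simp only [Finset.coe_biUnion, Set.mem_iUnion, Finset.mem_coe, Finset.mem_image] at hx
      obtain ⟨j, _, w, hw, rfl⟩ := hx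
      exact hmemD j w hw
    · intro v hv
      rw [← sum_emb v]
      refine Submodule.sum_mem _ fun j _ => ?_
      refine emb_span_mem (s := (s j : Set _)) ?_ ?_
      · intro w hw
        apply Submodule.subset_span
        simp only [Finset.coe_biUnion, Set.mem_iUnion, Finset.mem_coe, Finset.mem_image]
        exact ⟨j, Finset.mem_univ _, w, hw, rfl⟩
      · rw [hspan j]
        exact Submodule.subset_span ⟨v, hv, rfl⟩
  · intro G' hG' hspan'
    refine Set.Subset.antisymm hG' ?_
    intro x hx
    by_contra hxG
    simp only [Finset.coe_biUnion, Set.mem_iUnion, Finset.mem_coe, Finset.mem_image] at hx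
    obtain ⟨j, _, w, hw, rfl⟩ := hx
    apply hers j w hw
    unfold projCode
    rw [Submodule.span_le]
    rintro _ ⟨v, hv, rfl⟩
    rw [← hspan'] at hv
    refine proj_span_mem ?_ hv
    intro y hy
    have hy' := hG' hy
    simp only [Finset.coe_biUnion, Set.mem_iUnion, Finset.mem_coe, Finset.mem_image] at hy'
    obtain ⟨k, _, z, hz, rfl⟩ := hy'
    by_cases hjk : j = k
    · subst hjk
      rw [emb_same]
      apply Submodule.subset_span
      rw [Finset.mem_coe, Finset.mem_erase]
      refine ⟨?_, hz⟩
      rintro rfl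
      exact hxG hy
    · rw [emb_ne hjk]
      exact zero_mem _
  · intro g hg r
    simp only [Finset.mem_biUnion, Finset.mem_image] at hg
    obtain ⟨j, _, w, hw, rfl⟩ := hg
    by_cases hu : IsUnit (r j)
    · right
      obtain ⟨b, hb⟩ := hu.exists_left_inv
      refine ⟨Pi.single j b, ?_⟩
      rw [smul_emb, smul_emb, smul_smul, Pi.single_eq_same, hb, one_smul]
    · left
      rw [smul_emb, emb_smul]
      exact Submodule.smul_mem_smul (single_mem_jac j _ hu) (hmemD j w hw)

lemma Mnum_add [∀ j, Fintype (Rj j)] [∀ j, IsLocalRing (Rj j)]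
    (D : Submodule (∀ j, Rj j) (Fin n → ∀ j, Rj j)) :
    Mnum D + len ((⊥ : Ideal (∀ j, Rj j)).jacobson • D) = len D := by
  obtain ⟨G, hc, hG, hP⟩ := exists_min_gen D
  apply le_antisymm
  · rw [← hc]
    exact card_le_of_min hG
  · have := len_span_le _ G hP
    rw [hG.1, hc, sup_eq_left.2 Submodule.smul_le_right] at this
    exact this

end GenPart

section SuppPart

variable {R : Type*} [CommRing R] [Finite R] {n u : ℕ} {σ : (Fin n → R) → Fin u → ℕ}

lemma le_supp {D : Set (Fin n → R)} {v : Fin n → R} (hv : v ∈ D) (i : Fin u) :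
    σ v i ≤ suppOf σ D i :=
  le_csSup ((Set.toFinite _).bddAbove) ⟨v, hv, rfl⟩

lemma supp_le {D : Submodule R (Fin n → R)} {i : Fin u} {b : ℕ} (h : ∀ v ∈ D, σ v i ≤ b) :
    suppOf σ (D : Set (Fin n → R)) i ≤ b := by
  refine csSup_le ⟨_, 0, zero_mem D, rfl⟩ ?_
  rintro _ ⟨v, hv, rfl⟩
  exact h v hv

lemma exists_supp (D : Submodule R (Fin n → R)) (i : Fin u) :
    ∃ v ∈ D, σ v i = suppOf σ (D : Set (Fin n → R)) i :=
  Nat.sSup_mem (s := (fun v => σ v i) '' (D : Set (Fin n → R))) ⟨_, 0, zero_mem D, rfl⟩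
    ((Set.toFinite _).bddAbove)

lemma supp_mono {D E : Submodule R (Fin n → R)} (h : D ≤ E) (i : Fin u) :
    suppOf σ (D : Set (Fin n → R)) i ≤ suppOf σ (E : Set (Fin n → R)) i :=
  supp_le fun _ hv => le_supp (h hv) i

lemma exists_drop (hσ : IsSupport σ) (hmod : IsModular σ) (E : Submodule R (Fin n → R))
    (hE : E ≠ ⊥) : ∃ E' ≤ E, len E ≤ len E' + 1 ∧
      ∑ i, suppOf σ (E' : Set (Fin n → R)) i < ∑ i, suppOf σ (E : Set (Fin n → R)) i := by
  obtain ⟨h1, h2, h3⟩ := hσ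
  obtain ⟨v, hv, hv0⟩ := Submodule.exists_mem_ne_zero_of_ne_bot hE
  have : ∃ i, σ v i ≠ 0 := by
    by_contra! h
    exact hv0 ((h1 v).1 (funext h))
  obtain ⟨i, hi⟩ := this
  set m := suppOf σ (E : Set (Fin n → R)) i with hm
  have hm0 : 0 < m := lt_of_lt_of_le (Nat.pos_of_ne_zero hi) (le_supp hv i)
  let E' : Submodule R (Fin n → R) :=
    { carrier := {x | x ∈ E ∧ σ x i < m}
      zero_mem' := by
        refine ⟨zero_mem E, ?_⟩
        rw [(h1 0).2 rfl]
        exact hm0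
      add_mem' := by
        rintro a b ⟨ha, ha'⟩ ⟨hb, hb'⟩
        exact ⟨add_mem ha hb, lt_of_le_of_lt (h3 a b i) (max_lt ha' hb')⟩
      smul_mem' := by
        rintro r a ⟨ha, ha'⟩
        exact ⟨E.smul_mem r ha, lt_of_le_of_lt (h2 r a i) ha'⟩ }
  have hle : E' ≤ E := fun x hx => hx.1
  refine ⟨E', hle, ?_, ?_⟩
  · apply len_step hle
    intro x hx hxE y hy
    have hxm : m ≤ σ x i := by
      by_contra! h
      exact hxE ⟨hx, h⟩
    by_cases hym : σ y i < m
    · exact ⟨0, by rw [zero_smul, add_zero]; exact ⟨hy, hym⟩⟩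
    · have hym' : σ y i ≤ m := le_supp hy i
      have hyeq : σ y i = m := by omega
      obtain ⟨r, hr⟩ := hmod y x i (by omega) (by omega)
      exact ⟨r, add_mem hy (E.smul_mem r hx), by omega⟩
  · apply Finset.sum_lt_sum
    · intro k _
      exact supp_mono hle k
    · refine ⟨i, Finset.mem_univ _, ?_⟩
      obtain ⟨w, hw, hw'⟩ := exists_supp (σ := σ) E' i
      rw [← hw']
      exact hw.2

end SuppPart

/-- Theorem `monoton`: over a product `R = R_1 × … × R_ℓ` of finite
local rings with Jacobson radical `J`, for a modular support `σ` and a nonzero code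
`C ⊆ R^n` with either `C ⊆ 0:_{R^n} J` or each `R_j` a finite chain ring:
`min wt(C) = d_1(C) < d_2(C) < … < d_{M(C)}(C) = |σ(0:_C J)|`. -/
theorem stmt_16 {ℓ n u : ℕ} {Rj : Fin ℓ → Type*} [∀ j, CommRing (Rj j)] [∀ j, Fintype (Rj j)]
    [∀ j, IsLocalRing (Rj j)]
    (σ : (Fin n → ∀ j, Rj j) → Fin u → ℕ) (hσ : IsSupport σ) (hmod : IsModular σ)
    (C : Submodule (∀ j, Rj j) (Fin n → ∀ j, Rj j)) (hC : C ≠ ⊥)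
    (hcase : (∀ v ∈ C, ∀ r ∈ (⊥ : Ideal (∀ j, Rj j)).jacobson,
        r • v = (0 : Fin n → ∀ j, Rj j)) ∨ (∀ j, IsPrincipalIdealRing (Rj j))) :
    dGW σ 1 C = sInf {w | ∃ v ∈ C, v ≠ (0 : Fin n → ∀ j, Rj j) ∧ w = ∑ i, σ v i} ∧
    (∀ r, 1 ≤ r → r < Mnum C → dGW σ r C < dGW σ (r + 1) C) ∧
    dGW σ (Mnum C) C = ∑ i, suppOf σ (socJ C : Set (Fin n → ∀ j, Rj j)) i := by
  have hH : ∀ D ≤ C, Mnum D = len (socJ D) := by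
    intro D hD
    have h1 := Mnum_add D
    have h2 : len ((⊥ : Ideal (∀ j, Rj j)).jacobson • D) + len (socJ D) = len D := by
      rcases hcase with h | h
      · exact len_soc_case1 fun v hv => h v (hD hv)
      · exact len_soc_case2 D
    omega
  have hsocle : ∀ D : Submodule (∀ j, Rj j) (Fin n → ∀ j, Rj j), socJ D ≤ D :=
    fun D => inf_le_left
  -- subcodes of the socle have `Mnum` equal to their length
  have hsub : ∀ E ≤ socJ C, Mnum E = len E := by
    intro E hE
    rw [hH E (hE.trans (hsocle C))]
    congr 1
    refine le_antisymm (hsocle E) fun v hv => mem_socJ.2 ⟨hv, (mem_socJ.1 (hE hv)).2⟩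
  have hmem : ∀ D ≤ C, memS (Mnum D) C D := by
    intro D hD
    obtain ⟨G, hc, hG, _⟩ := exists_min_gen D
    exact ⟨hD, G, hc, hG⟩
  have hub : ∀ j D, memS j C D → j ≤ len (socJ D) := by
    rintro j D ⟨hD, G, rfl, hG⟩
    have h1 := card_le_of_min hG
    have h2 := Mnum_add D
    have h3 := hH D hD
    omega
  have hsocmono : ∀ D ≤ C, socJ D ≤ socJ C := fun D hD =>
    inf_le_inf_right _ hD
  have hatt : ∀ r ≤ Mnum C, ∃ j, r ≤ j ∧ ∃ D : Submodule (∀ j, Rj j) (Fin n → ∀ j, Rj j),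
      memS j C D ∧ dGW σ r C = ∑ i, suppOf σ (D : Set _) i := by
    intro r hr
    exact Nat.sInf_mem (s := {w | ∃ j, r ≤ j ∧
      ∃ D : Submodule (∀ j, Rj j) (Fin n → ∀ j, Rj j), memS j C D ∧
        w = ∑ i, suppOf σ (D : Set _) i}) ⟨_, _, hr, C, hmem C le_rfl, rfl⟩
  have hle : ∀ r j (D : Submodule (∀ j, Rj j) (Fin n → ∀ j, Rj j)), r ≤ j → memS j C D →
      dGW σ r C ≤ ∑ i, suppOf σ (D : Set _) i :=
    fun r j D hr hD => Nat.sInf_le ⟨j, hr, D, hD, rfl⟩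
  refine ⟨?_, ?_, ?_⟩
  · obtain ⟨v0, hv0, hv0'⟩ := Submodule.exists_mem_ne_zero_of_ne_bot hC
    have hcyc : ∀ v ∈ C, v ≠ 0 → memS 1 C (Submodule.span (∀ j, Rj j) {v}) := by
      intro v hv hv'
      refine ⟨by simpa [Submodule.span_le] using hv, {v}, by simp, by simp, ?_⟩
      intro G' hG' hs
      rw [Finset.coe_singleton] at hG' ⊢
      rcases Set.subset_singleton_iff_eq.1 hG' with h | h
      · subst h
        rw [Submodule.span_empty, eq_comm, Submodule.span_singleton_eq_bot] at hs
        exact absurd hs hv'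
      · exact h
    apply le_antisymm
    · obtain ⟨v, hv, hv', heq⟩ := Nat.sInf_mem
        (s := {w | ∃ v ∈ C, v ≠ (0 : Fin n → ∀ j, Rj j) ∧ w = ∑ i, σ v i})
        ⟨_, v0, hv0, hv0', rfl⟩
      rw [heq]
      refine (hle 1 1 _ le_rfl (hcyc v hv hv')).trans (Finset.sum_le_sum fun i _ => ?_)
      apply supp_le
      intro x hx
      obtain ⟨r, rfl⟩ := Submodule.mem_span_singleton.1 hx
      exact hσ.2.1 r v i
    · refine le_csInf ⟨_, 1, le_rfl, _, hcyc v0 hv0 hv0', rfl⟩ ?_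
      rintro _ ⟨j, hj, D, hD, rfl⟩
      have hD0 : D ≠ ⊥ := by
        rintro rfl
        have h1 := hub j _ hD
        have h2 := len_mono (hsocle (⊥ : Submodule (∀ j, Rj j) (Fin n → ∀ j, Rj j)))
        rw [len_bot] at h2
        omega
      obtain ⟨v, hv, hv'⟩ := Submodule.exists_mem_ne_zero_of_ne_bot hD0
      have hvm : ∑ i, σ v i ∈ {w | ∃ v ∈ C, v ≠ (0 : Fin n → ∀ j, Rj j) ∧ w = ∑ i, σ v i} :=
        ⟨v, hD.1 hv, hv', rfl⟩
      exact (Nat.sInf_le hvm).trans (Finset.sum_le_sum fun i _ => le_supp hv i)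
  · intro r hr hrM
    obtain ⟨j, hj, D, hD, heq⟩ := hatt (r + 1) hrM
    have hj' := hub j D hD
    have hE0 : socJ D ≠ ⊥ := by
      intro h
      rw [h, len_bot] at hj'
      omega
    obtain ⟨E, hE, hlen, hlt⟩ := exists_drop hσ hmod (socJ D) hE0
    have hEC : E ≤ socJ C := hE.trans (hsocmono D hD.1)
    have h1 := hle r (Mnum E) E (by rw [hsub E hEC]; omega) (hmem E (hEC.trans (hsocle C)))
    rw [heq]
    refine lt_of_le_of_lt h1 (lt_of_lt_of_le hlt (Finset.sum_le_sum fun i _ => ?_))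
    exact supp_mono (hsocle D) i
  · apply le_antisymm
    · refine hle _ (Mnum (socJ C)) (socJ C) ?_ (hmem _ (hsocle C))
      rw [hsub _ le_rfl, hH C le_rfl]
    · obtain ⟨j, hj, D, hD, heq⟩ := hatt (Mnum C) le_rfl
      have hj' := hub j D hD
      rw [hH C le_rfl] at hj
      have hs : socJ D = socJ C := by
        by_contra hne
        have := len_lt (lt_of_le_of_ne (hsocmono D hD.1) hne)
        omega
      rw [heq, ← hs]
      exact Finset.sum_le_sum fun i _ => supp_mono (hsocle D) i
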